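/- For every integer t ≥ 3 there exists a constant c > 0 such that for every integer n ≥ 2 and every finite field F, there exists a graph G on n vertices with independence number at most t − 1 (equivalently, whose complement is K_t-free) satisfying minrk_F(G) ≥ c · n^{1 − 2/(t+1)} / log(n · |F|). -/

import Mathlib

open Matrix

/-- `M` represents the graph `G` over a field: nonzero diagonal entries, and zero entries at
off-diagonal non-adjacent pairs. -/
def Represents {F V : Type*} [Field F] (M : Matrix V V F) (G : SimpleGraph V) : Prop :=
  (∀ v, M v v ≠ 0) ∧ ∀ u v, u ≠ v → ¬ G.Adj u v → M u v = 0

/-- The minrank of a graph `G` over a field `F`: the minimum possible rank of a matrix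
representing `G`. -/
noncomputable def minrk (F : Type*) [Field F] {V : Type*} [Fintype V]
    (G : SimpleGraph V) : ℕ :=
  sInf { r : ℕ | ∃ M : Matrix V V F, Represents M G ∧ M.rank = r }

/-- `G` contains a copy of `H` as a (not necessarily induced) subgraph, i.e. there is an
injective graph homomorphism from `H` to `G`. -/
def ContainsCopy {V W : Type*} (H : SimpleGraph W) (G : SimpleGraph V) : Prop :=
  ∃ f : W → V, Function.Injective f ∧ ∀ a b, H.Adj a b → G.Adj (f a) (f b)

open Finset in
theorem sum_biUnion_le_of_nonneg {ι α : Type*} [DecidableEq α] (s : Finset ι) (t : ι → Finset α)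
    {f : α → ℝ} (hf : ∀ a, 0 ≤ f a) :
    ∑ a ∈ s.biUnion t, f a ≤ ∑ i ∈ s, ∑ a ∈ t i, f a := by
  classical
  induction s using Finset.induction_on with
  | empty => simp
  | insert i s hi ih =>
    rw [biUnion_insert, sum_insert hi]
    have h := sum_union_inter (s₁ := t i) (s₂ := s.biUnion t) (f := f)
    have h' : 0 ≤ ∑ a ∈ t i ∩ s.biUnion t, f a := sum_nonneg fun a _ => hf a
    linarith

open Finset in
/-- The product of independent Bernoulli weights: the total weight of the sets containing `A` and
avoiding `B` is at most `p ^ |A| * (1 - p) ^ |B|`. -/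
theorem sum_bernoulli_weight_le {E : Type*} [Fintype E] [DecidableEq E] {p : ℝ} (hp0 : 0 ≤ p)
    (hp1 : p ≤ 1) {A B : Finset E} (hAB : Disjoint A B) :
    ∑ H ∈ univ.filter (fun H : Finset E => A ⊆ H ∧ Disjoint H B),
      p ^ #H * (1 - p) ^ #(univ \ H) ≤ p ^ #A * (1 - p) ^ #B := by
  set f : E → ℝ := fun e => if e ∈ B then 0 else p with hf
  set g : E → ℝ := fun e => if e ∈ A then 0 else 1 - p with hg
  have hf0 : ∀ e, 0 ≤ f e := fun e => by simp only [hf]; split_ifs <;> linarith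
  have hg0 : ∀ e, 0 ≤ g e := fun e => by simp only [hg]; split_ifs <;> linarith
  have hprod : ∏ e, (f e + g e) = p ^ #A * (1 - p) ^ #B := by
    have h : ∀ e, f e + g e = (if e ∈ A then p else 1) * (if e ∈ B then 1 - p else 1) := by
      intro e
      by_cases hA : e ∈ A
      · have hB : e ∉ B := Finset.disjoint_left.1 hAB hA
        simp [hf, hg, hA, hB]
      · by_cases hB : e ∈ B <;> simp [hf, hg, hA, hB]
    simp only [h, prod_mul_distrib, prod_ite_mem, univ_inter, prod_const]
  rw [← hprod, prod_add, powerset_univ]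
  calc _ ≤ ∑ H ∈ univ.filter (fun H : Finset E => A ⊆ H ∧ Disjoint H B),
        (∏ e ∈ H, f e) * ∏ e ∈ univ \ H, g e := by
        refine sum_le_sum fun H hH => ?_
        obtain ⟨hA, hB⟩ := (mem_filter.1 hH).2
        rw [prod_congr rfl (g := fun _ => p), prod_congr rfl (g := fun _ => 1 - p) (s₁ := univ \ H),
          prod_const, prod_const]
        · intro e he
          have : e ∉ A := fun h => (mem_sdiff.1 he).2 (hA h)
          simp [hg, this]
        · intro e he
          have : e ∉ B := Finset.disjoint_left.1 hB he
          simp [hf, this]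
    _ ≤ _ := sum_le_sum_of_subset_of_nonneg (filter_subset _ _) fun H _ _ =>
        mul_nonneg (prod_nonneg fun e _ => hf0 e) (prod_nonneg fun e _ => hg0 e)

open Finset in
theorem exists_maximal_disjoint_subfamily {E : Type*} [DecidableEq E]
    (𝒯 : Finset (Finset E)) (h𝒯 : ∀ T ∈ 𝒯, T.Nonempty) (H : Finset E) :
    ∃ 𝓕 ⊆ 𝒯, (∀ T ∈ 𝓕, T ⊆ H) ∧ (𝓕 : Set (Finset E)).PairwiseDisjoint id ∧
      ∀ T ∈ 𝒯, ¬ T ⊆ H \ 𝓕.biUnion id := by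
  classical
  obtain ⟨𝓕, h𝓕⟩ := Finset.exists_maximal
    (s := 𝒯.powerset.filter fun 𝓕 : Finset (Finset E) =>
      (∀ T ∈ 𝓕, T ⊆ H) ∧ (𝓕 : Set (Finset E)).PairwiseDisjoint id)
    ⟨∅, by simp⟩
  have hmem := h𝓕.prop
  simp only [mem_filter, mem_powerset] at hmem
  refine ⟨𝓕, hmem.1, hmem.2.1, hmem.2.2, fun T hT hTH => ?_⟩
  have hdisj : ∀ T' ∈ 𝓕, Disjoint T T' := fun T' hT' => by
    refine Finset.disjoint_left.2 fun e he he' => ?_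
    exact (mem_sdiff.1 (hTH he)).2 (mem_biUnion.2 ⟨T', hT', he'⟩)
  have hins : insert T 𝓕 ∈ 𝒯.powerset.filter
      fun 𝓕 : Finset (Finset E) =>
        (∀ T ∈ 𝓕, T ⊆ H) ∧ (𝓕 : Set (Finset E)).PairwiseDisjoint id := by
    simp only [mem_filter, mem_powerset]
    refine ⟨insert_subset hT hmem.1, ?_, ?_⟩
    · intro T' hT'
      rcases mem_insert.1 hT' with rfl | h
      · exact hTH.trans sdiff_subset
      · exact hmem.2.1 _ h
    · rw [coe_insert]
      exact hmem.2.2.insert fun T' hT' _ => hdisj T' hT'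
  have hTF : T ∈ 𝓕 := h𝓕.le_of_ge hins (subset_insert T 𝓕) (mem_insert_self T 𝓕)
  obtain ⟨e, he⟩ := h𝒯 T hT
  exact Finset.disjoint_left.1 (hdisj T hTF) he he

open Finset in
/-- Delete from a random set `H` a maximal disjoint family of forbidden sets `r H`: the weight of
those `H` for which the remainder misses `S` decays exponentially in `|S|`. -/
theorem sum_weight_remainder_disjoint_le {E : Type*} [Fintype E] [DecidableEq E]
    {𝒯 : Finset (Finset E)} {C N : ℕ} (hcard : ∀ T ∈ 𝒯, #T = C)
    (hdeg : ∀ e, #(𝒯.filter (e ∈ ·)) ≤ N) {p : ℝ} (hp0 : 0 ≤ p) (hp2 : p ≤ 1 / 2)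
    (hp : (2 * p) ^ C * N ≤ p / 2) {r : Finset E → Finset (Finset E)} (hr : ∀ H, r H ⊆ 𝒯)
    (hrH : ∀ H, ∀ T ∈ r H, T ⊆ H) (hrd : ∀ H, (r H : Set (Finset E)).PairwiseDisjoint id)
    (S : Finset E) :
    ∑ H ∈ univ.filter (fun H : Finset E => Disjoint (H \ (r H).biUnion id) S),
      p ^ #H * (1 - p) ^ #(univ \ H) ≤ Real.exp (-(p * #S / 2)) := by
  classical
  set w : Finset E → ℝ := fun H => p ^ #H * (1 - p) ^ #(univ \ H) with hw
  have hw0 : ∀ H, 0 ≤ w H := fun H => by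
    have : 0 ≤ 1 - p := by linarith
    positivity
  have hq : 0 < 1 - p := by linarith
  set 𝒯S := 𝒯.filter fun T => ¬ Disjoint T S with h𝒯S
  set Φ := 𝒯S.powerset.filter fun 𝓕 : Finset (Finset E) =>
    (𝓕 : Set (Finset E)).PairwiseDisjoint id with hΦ
  set x : ℝ := (p / (1 - p)) ^ C with hx
  have hx0 : 0 ≤ x := by positivity
  have hxN : x * N ≤ p / 2 := by
    refine le_trans (mul_le_mul_of_nonneg_right (pow_le_pow_left₀ (by positivity) ?_ C)
      (Nat.cast_nonneg N)) hp
    rw [div_le_iff₀ hq]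
    nlinarith
  have hcover : (univ.filter fun H : Finset E => Disjoint (H \ (r H).biUnion id) S) ⊆
      Φ.biUnion fun 𝓕 => univ.filter fun H : Finset E =>
        𝓕.biUnion id ⊆ H ∧ Disjoint H (S \ 𝓕.biUnion id) := by
    intro H hH
    have hH' := (mem_filter.1 hH).2
    refine mem_biUnion.2 ⟨(r H).filter fun T => ¬ Disjoint T S, ?_, ?_⟩
    · refine mem_filter.2 ⟨mem_powerset.2 (filter_subset_filter _ (hr H)), ?_⟩
      exact (hrd H).subset (by simp [Set.subset_def]; tauto)
    · refine mem_filter.2 ⟨mem_univ _, ?_, ?_⟩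
      · refine biUnion_subset.2 fun T hT => hrH H T (mem_filter.1 hT).1
      · refine Finset.disjoint_left.2 fun e he heS => ?_
        obtain ⟨heS, hne⟩ := mem_sdiff.1 heS
        have : e ∈ (r H).biUnion id := by
          by_contra hcon
          exact Finset.disjoint_left.1 hH' (mem_sdiff.2 ⟨he, hcon⟩) heS
        obtain ⟨T, hT, heT⟩ := mem_biUnion.1 this
        exact hne (mem_biUnion.2 ⟨T, mem_filter.2
          ⟨hT, fun hd => Finset.disjoint_left.1 hd heT heS⟩, heT⟩)
  have hterm : ∀ 𝓕 ∈ Φ, ∑ H ∈ univ.filter (fun H : Finset E =>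
      𝓕.biUnion id ⊆ H ∧ Disjoint H (S \ 𝓕.biUnion id)), w H ≤ (1 - p) ^ #S * x ^ #𝓕 := by
    intro 𝓕 h𝓕
    obtain ⟨hsub, hd⟩ := mem_filter.1 h𝓕
    have hcardU : #(𝓕.biUnion id) = #𝓕 * C := by
      rw [card_biUnion hd, sum_const_nat]
      intro T hT
      exact hcard T (mem_filter.1 (mem_powerset.1 hsub hT)).1
    refine (sum_bernoulli_weight_le hp0 (by linarith) disjoint_sdiff).trans ?_
    have hle : #S ≤ #(S \ 𝓕.biUnion id) + #𝓕 * C := by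
      rw [← hcardU, card_sdiff_add_card]
      exact card_le_card subset_union_left
    have h1 : (1 - p) ^ (#(S \ 𝓕.biUnion id) + #𝓕 * C) ≤ (1 - p) ^ #S :=
      pow_le_pow_of_le_one hq.le (by linarith) hle
    rw [hcardU, hx, ← pow_mul, div_pow, mul_comm C, mul_div_assoc', le_div_iff₀ (by positivity)]
    calc _ = p ^ (#𝓕 * C) * (1 - p) ^ (#(S \ 𝓕.biUnion id) + #𝓕 * C) := by ring
      _ ≤ p ^ (#𝓕 * C) * (1 - p) ^ #S := by gcongr
      _ = _ := by ring
  have hcardT : #𝒯S ≤ #S * N := by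
    have : 𝒯S ⊆ S.biUnion fun e => 𝒯.filter (e ∈ ·) := by
      intro T hT
      obtain ⟨hT, hTS⟩ := mem_filter.1 hT
      obtain ⟨e, heT, heS⟩ := Finset.not_disjoint_iff.1 hTS
      exact mem_biUnion.2 ⟨e, heS, mem_filter.2 ⟨hT, heT⟩⟩
    exact (card_le_card this).trans (card_biUnion_le_card_mul _ _ _ fun e _ => hdeg e)
  calc _ ≤ ∑ H ∈ Φ.biUnion fun 𝓕 => univ.filter fun H : Finset E =>
        𝓕.biUnion id ⊆ H ∧ Disjoint H (S \ 𝓕.biUnion id), w H :=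
        sum_le_sum_of_subset_of_nonneg hcover fun H _ _ => hw0 H
    _ ≤ ∑ 𝓕 ∈ Φ, ∑ H ∈ univ.filter (fun H : Finset E =>
        𝓕.biUnion id ⊆ H ∧ Disjoint H (S \ 𝓕.biUnion id)), w H :=
        sum_biUnion_le_of_nonneg _ _ hw0
    _ ≤ ∑ 𝓕 ∈ Φ, (1 - p) ^ #S * x ^ #𝓕 := sum_le_sum hterm
    _ ≤ ∑ 𝓕 ∈ 𝒯S.powerset, (1 - p) ^ #S * x ^ #𝓕 :=
        sum_le_sum_of_subset_of_nonneg (filter_subset _ _) fun _ _ _ => by positivity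
    _ = (1 - p) ^ #S * (1 + x) ^ #𝒯S := by
        have h := prod_one_add (f := fun _ => x) 𝒯S
        simp only [prod_const] at h
        rw [← mul_sum, h]
    _ ≤ (Real.exp (-p)) ^ #S * (Real.exp x) ^ (#S * N) := by
        gcongr
        · exact Real.one_sub_le_exp_neg p
        · calc (1 + x) ^ #𝒯S ≤ (1 + x) ^ (#S * N) := pow_le_pow_right₀ (by linarith) hcardT
            _ ≤ _ := by
              gcongr
              linarith [Real.add_one_le_exp x]
    _ = Real.exp (-(p * #S) + #S * (x * N)) := by
        rw [← Real.exp_nat_mul, ← Real.exp_nat_mul, ← Real.exp_add]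
        congr 1
        push_cast
        ring
    _ ≤ _ := by
        apply Real.exp_le_exp.2
        have : (#S : ℝ) * (x * N) ≤ #S * (p / 2) := by gcongr
        linarith

open Finset in
/-- If the sets `S i` are collectively large, some set contains no member of `𝒯` and meets every
`S i`. -/
theorem exists_avoiding_hitting {E ι : Type*} [Fintype E] [DecidableEq E]
    {𝒯 : Finset (Finset E)} {C N : ℕ} (hC : 0 < C) (hcard : ∀ T ∈ 𝒯, #T = C)
    (hdeg : ∀ e, #(𝒯.filter (e ∈ ·)) ≤ N) {p : ℝ} (hp0 : 0 ≤ p) (hp2 : p ≤ 1 / 2)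
    (hp : (2 * p) ^ C * N ≤ p / 2) (s : Finset ι) (S : ι → Finset E)
    (hsum : ∑ i ∈ s, Real.exp (-(p * #(S i) / 2)) < 1) :
    ∃ H : Finset E, (∀ T ∈ 𝒯, ¬ T ⊆ H) ∧ ∀ i ∈ s, ∃ e ∈ S i, e ∈ H := by
  classical
  have hne : ∀ T ∈ 𝒯, T.Nonempty := fun T hT => card_pos.1 (by rw [hcard T hT]; exact hC)
  choose r hr hrH hrd hrT using exists_maximal_disjoint_subfamily 𝒯 hne
  suffices h : ∃ H : Finset E, ∀ i ∈ s, ¬ Disjoint (H \ (r H).biUnion id) (S i) by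
    obtain ⟨H, hH⟩ := h
    refine ⟨H \ (r H).biUnion id, hrT H, fun i hi => ?_⟩
    obtain ⟨e, he, heS⟩ := Finset.not_disjoint_iff.1 (hH i hi)
    exact ⟨e, heS, he⟩
  by_contra! hcon
  set w : Finset E → ℝ := fun H => p ^ #H * (1 - p) ^ #(univ \ H) with hw
  have hw0 : ∀ H, 0 ≤ w H := fun H => by
    have : 0 ≤ 1 - p := by linarith
    positivity
  have htotal : ∑ H : Finset E, w H = 1 := by
    have h := prod_add (fun _ : E => p) (fun _ => 1 - p) univ
    simp only [prod_const, powerset_univ] at h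
    rw [hw, ← h]
    simp
  have hcover : (univ : Finset (Finset E)) ⊆ s.biUnion fun i =>
      univ.filter fun H => Disjoint (H \ (r H).biUnion id) (S i) := by
    intro H _
    obtain ⟨i, hi, hd⟩ := hcon H
    exact mem_biUnion.2 ⟨i, hi, mem_filter.2 ⟨mem_univ _, hd⟩⟩
  have : (1 : ℝ) ≤ ∑ i ∈ s, Real.exp (-(p * #(S i) / 2)) :=
    calc (1 : ℝ) = ∑ H : Finset E, w H := htotal.symm
      _ ≤ _ := sum_le_sum_of_subset_of_nonneg hcover fun H _ _ => hw0 H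
      _ ≤ _ := sum_biUnion_le_of_nonneg _ _ hw0
      _ ≤ _ := sum_le_sum fun i _ =>
        sum_weight_remainder_disjoint_le hcard hdeg hp0 hp2 hp hr hrH hrd (S i)
  linarith

/-- Greedy choice of a spanning subfamily: if every `W ⊆ U` spans a space of dimension at least
`(r / |U|) * |W|`, then some spanning subfamily of `U` has at most an `r / |U|` proportion of the
total cost. -/
theorem exists_cheap_spanning_subset {K V E : Type*} [Field K] [AddCommGroup E] [Module K E]
    [DecidableEq V] (v : V → E) (c : V → ℕ) (U : Finset V) {r : ℕ}
    (hdense : ∀ W ⊆ U, r * W.card ≤ U.card * Module.finrank K (Submodule.span K (v '' W)))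
    (hr : Module.finrank K (Submodule.span K (v '' U)) = r) :
    ∃ J ⊆ U, (∀ j ∈ U, v j ∈ Submodule.span K (v '' J)) ∧
      U.card * ∑ j ∈ J, c j ≤ r * ∑ j ∈ U, c j := by
  have key : ∀ τ : ℕ, ∃ J ⊆ U.filter (c · < τ), LinearIndepOn K v (J : Set V) ∧
      (∀ j ∈ U.filter (c · < τ), v j ∈ Submodule.span K (v '' J)) ∧
      r * ∑ j ∈ U, (τ - c j) ≤ U.card * ∑ j ∈ J, (τ - c j) := by
    intro τ
    induction τ with
    | zero => exact ⟨∅, by simp, by simp, by simp, by simp⟩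
    | succ τ ih =>
      obtain ⟨J, hJ, hli, -, hsum⟩ := ih
      have hmono : U.filter (c · < τ) ⊆ U.filter (c · < τ + 1) := fun j hj => by
        simp only [Finset.mem_filter] at hj ⊢
        exact ⟨hj.1, by omega⟩
      obtain ⟨b, hbt, hJb, hspan, hbli⟩ := exists_linearIndepOn_extension hli
        (Finset.coe_subset.2 (hJ.trans hmono))
      have hbfin : b.Finite := (Finset.finite_toSet _).subset hbt
      lift b to Finset V using hbfin
      rw [Finset.coe_subset] at hbt hJb
      have hcard : r * (U.filter (c · < τ + 1)).card ≤ U.card * b.card := by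
        have h := hdense _ (Finset.filter_subset (c · < τ + 1) U)
        have h1 : Submodule.span K (v '' (U.filter (c · < τ + 1) : Finset V)) =
            Submodule.span K (v '' b) :=
          le_antisymm (Submodule.span_le.2 hspan)
            (Submodule.span_mono (Set.image_mono (Finset.coe_subset.2 hbt)))
        have h2 : Module.finrank K (Submodule.span K (v '' (b : Set V))) = b.card := by
          have h3 := finrank_span_eq_card (R := K) hbli
          rw [← Set.image_eq_range] at h3
          simpa using h3
        rwa [h1, h2] at h
      have hstep : ∀ j, τ + 1 - c j = (τ - c j) + if c j < τ + 1 then 1 else 0 := fun j => by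
        split_ifs <;> omega
      refine ⟨b, hbt, hbli, fun j hj => hspan ⟨j, hj, rfl⟩, ?_⟩
      simp only [hstep, Finset.sum_add_distrib, ← Finset.card_filter, mul_add]
      have hb : b.filter (c · < τ + 1) = b :=
        Finset.filter_true_of_mem fun j hj => (Finset.mem_filter.1 (hbt hj)).2
      rw [hb]
      have hle : ∑ j ∈ J, (τ - c j) ≤ ∑ j ∈ b, (τ - c j) := Finset.sum_le_sum_of_subset hJb
      have := Nat.mul_le_mul_left U.card hle
      omega
  obtain ⟨J, hJ, hli, hspan, hsum⟩ := key (U.sup c + 1)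
  have hlt : ∀ j ∈ U, c j < U.sup c + 1 := fun j hj => Nat.lt_succ_of_le (Finset.le_sup hj)
  rw [Finset.filter_true_of_mem hlt] at hJ hspan
  refine ⟨J, hJ, hspan, ?_⟩
  have hJcard : J.card = r := by
    have h3 := finrank_span_eq_card (R := K) hli
    rw [← Set.image_eq_range] at h3
    rw [← hr, ← le_antisymm (Submodule.span_mono (Set.image_mono (Finset.coe_subset.2 hJ)))
      (Submodule.span_le.2 (Set.image_subset_iff.2 hspan)), h3]
    simp
  have hsplit : ∀ W ⊆ U, ∑ j ∈ W, (U.sup c + 1 - c j) + ∑ j ∈ W, c j = W.card * (U.sup c + 1) := by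
    intro W hW
    rw [← Finset.sum_add_distrib, Finset.sum_const_nat]
    intro j hj
    have := hlt j (hW hj)
    omega
  have h1 := hsplit J hJ
  have h2 := hsplit U subset_rfl
  rw [hJcard] at h1
  nlinarith

/-- `C` is obtained from `A` by setting some columns to zero, and has the same column space. -/
def IsColPart {F V : Type*} [Field F] (C A : Matrix V V F) : Prop :=
  (∀ j, C.col j = A.col j ∨ C.col j = 0) ∧ ∀ j, A.col j ∈ Submodule.span F (Set.range C.col)

/-- The number of nonzero entries of a matrix. -/
noncomputable def entryCount {F V : Type*} [Field F] [Fintype V] (A : Matrix V V F) : ℕ :=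
  open Classical in (Finset.univ.filter fun x : V × V => A x.1 x.2 ≠ 0).card

/-- The pairs `s(i, j)` with `i ≠ j` at which `A` has a nonzero entry. -/
noncomputable def offDiagSupport {F V : Type*} [Field F] [Fintype V] (A : Matrix V V F) :
    Finset (Sym2 V) :=
  open Classical in (Finset.univ.filter fun x : V × V => x.1 ≠ x.2 ∧ A x.1 x.2 ≠ 0).image
    (Function.uncurry Sym2.mk)

/-- The principal submatrix on `U`, padded with zeros. -/
def principalPart {F V : Type*} [Field F] [DecidableEq V] (M : Matrix V V F) (U : Finset V) :
    Matrix V V F :=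
  Matrix.of fun i j => if i ∈ U ∧ j ∈ U then M i j else 0

/-- A matrix is determined by a spanning set of its columns and a spanning set of its rows. -/
theorem eq_of_isColPart {F V : Type*} [Field F] [Fintype V] [DecidableEq V]
    {A B C R : Matrix V V F}
    (hCA : IsColPart C A) (hCB : IsColPart C B) (hRA : IsColPart R (Aᵀ)) (hRB : IsColPart R (Bᵀ)) :
    A = B := by
  have hspan : Submodule.span F (Set.range C.col) ≤ Submodule.span F (Set.range A.col) := by
    refine Submodule.span_le.2 ?_
    rintro _ ⟨j, rfl⟩
    rcases hCA.1 j with h | h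
    · rw [h]
      exact Submodule.subset_span ⟨j, rfl⟩
    · rw [h]
      exact Submodule.zero_mem _
  have hcol : ∀ j, A.col j = B.col j := by
    intro j
    have hmem : A.col j - B.col j ∈ Submodule.span F (Set.range A.col) :=
      hspan (Submodule.sub_mem _ (hCA.2 j) (hCB.2 j))
    rw [← Matrix.range_mulVecLin] at hmem
    obtain ⟨z, hz⟩ := hmem
    rw [Matrix.mulVecLin_apply] at hz
    have hzero : ∀ x ∈ Submodule.span F (Set.range R.col), x ⬝ᵥ z = 0 := by
      intro x hx
      induction hx using Submodule.span_induction with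
      | mem x hx =>
        obtain ⟨i, rfl⟩ := hx
        rcases hRA.1 i with h | h
        · rcases hRB.1 i with h' | h'
          · have h1 : (A *ᵥ z) i = 0 := by
              have h2 := congrFun (h.symm.trans h') j
              rw [hz]
              simpa [sub_eq_zero] using h2
            rw [h]
            exact h1
          · rw [h', zero_dotProduct]
        · rw [h, zero_dotProduct]
      | zero => exact zero_dotProduct z
      | add x y _ _ hx hy => rw [add_dotProduct, hx, hy, add_zero]
      | smul a x _ hx => rw [smul_dotProduct, hx, smul_zero]
    have h0 : A *ᵥ z = 0 := funext fun i => hzero _ (hRA.2 i)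
    rw [h0] at hz
    exact (sub_eq_zero.1 hz.symm)
  ext i j
  exact congrFun (hcol j) i

theorem rank_principalPart_le_finrank_span {F V : Type*} [Field F] [Fintype V] [DecidableEq V]
    (M : Matrix V V F) {U W : Finset V} (hWU : W ⊆ U) :
    (principalPart M W).rank ≤
      Module.finrank F (Submodule.span F ((principalPart M U).col '' W)) := by
  set φ : (V → F) →ₗ[F] (V → F) := LinearMap.pi fun i => if i ∈ W then LinearMap.proj i else 0
    with hφ
  rw [Matrix.rank_eq_finrank_span_cols]
  refine le_trans (Submodule.finrank_mono ?_) (Submodule.finrank_map_le φ _)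
  refine Submodule.span_le.2 ?_
  rintro _ ⟨j, rfl⟩
  by_cases hj : j ∈ W
  · refine ⟨(principalPart M U).col j, Submodule.subset_span ⟨j, hj, rfl⟩, ?_⟩
    ext i
    by_cases hi : i ∈ W
    · simp [hφ, principalPart, hi, hj, hWU hi, hWU hj]
    · simp [hφ, principalPart, hi]
  · have : (principalPart M W).col j = 0 := by
      ext i
      simp [principalPart, hj]
    rw [this]
    exact Submodule.zero_mem _

theorem transpose_principalPart {F V : Type*} [Field F] [DecidableEq V] (M : Matrix V V F)
    (U : Finset V) : (principalPart M U)ᵀ = principalPart (Mᵀ) U := by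
  ext i j
  simp [principalPart, and_comm]

theorem entryCount_transpose {F V : Type*} [Field F] [Fintype V] (A : Matrix V V F) :
    entryCount (Aᵀ) = entryCount A := by
  classical
  unfold entryCount
  refine Finset.card_bij (fun x _ => x.swap) (fun x hx => ?_)
    (fun _ _ _ _ h => Prod.swap_injective h) fun x hx => ⟨x.swap, ?_, x.swap_swap⟩
  all_goals exact Finset.mem_filter.2 ⟨Finset.mem_univ _, (Finset.mem_filter.1 hx).2⟩

theorem entryCount_eq_sum {F V : Type*} [Field F] [Fintype V] [DecidableEq F]
    (A : Matrix V V F) :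
    entryCount A = ∑ j, (Finset.univ.filter fun i => A i j ≠ 0).card := by
  classical
  unfold entryCount
  rw [← Finset.univ_product_univ, Finset.card_filter, Finset.sum_product_right]
  refine Finset.sum_congr rfl fun j _ => ?_
  rw [Finset.card_filter]
  refine Finset.sum_congr rfl fun i _ => ?_
  congr

/-- A principal submatrix minimizing rank over size has a sparse column part. -/
theorem exists_sparse_isColPart {F V : Type*} [Field F] [Fintype V] [DecidableEq V]
    (M : Matrix V V F) (U : Finset V)
    (hmin : ∀ W ⊆ U, (principalPart M U).rank * W.card ≤ U.card * (principalPart M W).rank) :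
    ∃ C : Matrix V V F, IsColPart C (principalPart M U) ∧
      U.card * entryCount C ≤ (principalPart M U).rank * entryCount (principalPart M U) := by
  classical
  set A := principalPart M U with hA
  have hout : ∀ j ∉ U, A.col j = 0 := fun j hj => by
    ext i
    simp [hA, principalPart, hj]
  have hspanU : Submodule.span F (A.col '' U) = Submodule.span F (Set.range A.col) := by
    refine le_antisymm (Submodule.span_mono (Set.image_subset_range _ _)) (Submodule.span_le.2 ?_)
    rintro _ ⟨j, rfl⟩
    by_cases hj : j ∈ U
    · exact Submodule.subset_span ⟨j, hj, rfl⟩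
    · rw [hout j hj]
      exact Submodule.zero_mem _
  obtain ⟨J, hJU, hJ, hcost⟩ := exists_cheap_spanning_subset (K := F) A.col
    (fun j => (Finset.univ.filter fun i => A i j ≠ 0).card) U (r := A.rank)
    (fun W hW => (hmin W hW).trans
      (Nat.mul_le_mul_left _ (rank_principalPart_le_finrank_span M hW)))
    (by rw [hspanU, Matrix.rank_eq_finrank_span_cols])
  set C : Matrix V V F := Matrix.of fun i j => if j ∈ J then A i j else 0 with hC
  have hin : ∀ j ∈ J, C.col j = A.col j := fun j hj => by
    ext i
    simp [hC, hj]
  refine ⟨C, ⟨fun j => ?_, fun j => ?_⟩, ?_⟩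
  · by_cases hj : j ∈ J
    · exact Or.inl (hin j hj)
    · right
      ext i
      simp [hC, hj]
  · by_cases hj : j ∈ U
    · refine Submodule.span_mono ?_ (hJ j hj)
      rintro _ ⟨j', hj', rfl⟩
      exact ⟨j', hin j' hj'⟩
    · rw [hout j hj]
      exact Submodule.zero_mem _
  · have h1 : entryCount C = ∑ j ∈ J, (Finset.univ.filter fun i => A i j ≠ 0).card := by
      rw [entryCount_eq_sum, ← Finset.sum_subset (Finset.subset_univ J)]
      · refine Finset.sum_congr rfl fun j hj => ?_
        simp [hC, hj]
      · intro j _ hj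
        simp [hC, hj]
    have h2 : ∑ j ∈ U, (Finset.univ.filter fun i => A i j ≠ 0).card ≤ entryCount A := by
      rw [entryCount_eq_sum]
      exact Finset.sum_le_sum_of_subset (Finset.subset_univ U)
    rw [h1]
    exact hcost.trans (Nat.mul_le_mul_left _ h2)

theorem rank_principalPart_univ {F V : Type*} [Field F] [Fintype V] [DecidableEq V]
    (M : Matrix V V F) : (principalPart M Finset.univ).rank = M.rank := by
  congr 1
  ext i j
  simp [principalPart]

/-- If the diagonal is nonzero on `U` and the rank of the principal submatrix on `U` is at most
`|U| / 2`, then a constant fraction of its nonzero entries is off the diagonal. -/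
theorem entryCount_principalPart_le {F V : Type*} [Field F] [Fintype V] [DecidableEq V]
    (M : Matrix V V F) (hM : ∀ i, M i i ≠ 0) (U : Finset V)
    (hU : 2 * (principalPart M U).rank ≤ U.card) :
    entryCount (principalPart M U) ≤ 6 * (offDiagSupport (principalPart M U)).card := by
  classical
  set A := principalPart M U with hA
  have hzero : ∀ i j, A i j ≠ 0 → i ∈ U ∧ j ∈ U := fun i j h => by
    by_contra hcon
    exact h (by simp [hA, principalPart, hcon])
  set O : Finset (V × V) := Finset.univ.filter fun x => x.1 ≠ x.2 ∧ A x.1 x.2 ≠ 0 with hO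
  set D : Finset V := U.filter fun i => ∀ j, j ≠ i → A i j = 0 with hD
  have hDU : D ⊆ U := Finset.filter_subset _ _
  have hDcard : D.card ≤ A.rank := by
    have hdiag : principalPart M D = Matrix.diagonal fun i => if i ∈ D then M i i else 0 := by
      ext i j
      by_cases hij : i = j
      · subst hij
        simp [principalPart]
      · rw [Matrix.diagonal_apply_ne _ hij]
        by_cases hmem : i ∈ D ∧ j ∈ D
        · have h := (Finset.mem_filter.1 hmem.1).2 j (Ne.symm hij)
          simpa [hA, principalPart, hmem, hDU hmem.1, hDU hmem.2] using h
        · simp [principalPart, hmem]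
    have hrank : (principalPart M D).rank = D.card := by
      rw [hdiag, Matrix.rank_diagonal, Fintype.card_subtype]
      congr 1
      ext i
      simp [hM i]
    rw [← hrank, Matrix.rank_eq_finrank_span_cols A]
    exact (rank_principalPart_le_finrank_span M hDU).trans
      (Submodule.finrank_mono (Submodule.span_mono (Set.image_subset_range _ _)))
  have hUD : (U \ D).card ≤ O.card := by
    have hsub : U \ D ⊆ O.image Prod.fst := by
      intro i hi
      obtain ⟨hiU, hiD⟩ := Finset.mem_sdiff.1 hi
      have hex : ¬ ∀ j, j ≠ i → A i j = 0 := fun h => hiD (Finset.mem_filter.2 ⟨hiU, h⟩)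
      push Not at hex
      obtain ⟨j, hji, hj⟩ := hex
      exact Finset.mem_image.2
        ⟨(i, j), Finset.mem_filter.2 ⟨Finset.mem_univ _, Ne.symm hji, hj⟩, rfl⟩
    exact (Finset.card_le_card hsub).trans Finset.card_image_le
  have hcount : entryCount A ≤ U.card + O.card := by
    have hsub : (Finset.univ.filter fun x : V × V => A x.1 x.2 ≠ 0) ⊆
        U.image (fun i => (i, i)) ∪ O := by
      rintro ⟨i, j⟩ hx
      have hx' := (Finset.mem_filter.1 hx).2
      by_cases hij : i = j
      · subst hij
        exact Finset.mem_union_left _ (Finset.mem_image.2 ⟨i, (hzero i i hx').1, rfl⟩)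
      · exact Finset.mem_union_right _ (Finset.mem_filter.2 ⟨Finset.mem_univ _, hij, hx'⟩)
    have h := (Finset.card_le_card hsub).trans ((Finset.card_union_le _ _).trans
      (Nat.add_le_add_right Finset.card_image_le _))
    unfold entryCount
    convert h
  have hOS : O.card ≤ 2 * (offDiagSupport A).card := by
    have himg : offDiagSupport A = O.image (Function.uncurry Sym2.mk) := by
      unfold offDiagSupport
      rw [hO]
      congr
      funext a b
      exact Subsingleton.elim _ _
    rw [himg]
    refine Finset.card_le_mul_card_image _ _ fun b _ => ?_
    induction b using Sym2.ind with
    | _ i j =>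
      refine (Finset.card_le_card (t := {(i, j), (j, i)}) ?_).trans Finset.card_le_two
      rintro ⟨k, l⟩ hx
      have h := (Finset.mem_filter.1 hx).2
      simpa using h
  have h1 := Finset.card_sdiff_add_card_eq_card hDU
  omega

theorem one_le_entryCount_of_isColPart {F V : Type*} [Field F] [Fintype V]
    {C A : Matrix V V F} (h : IsColPart C A) (hA : A ≠ 0) : 1 ≤ entryCount C := by
  classical
  rw [Nat.one_le_iff_ne_zero]
  intro h0
  unfold entryCount at h0
  rw [Finset.card_eq_zero] at h0
  have hC : ∀ j, C.col j = 0 := fun j => by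
    ext i
    by_contra hne
    exact Finset.notMem_empty (i, j)
      (h0 ▸ Finset.mem_filter.2 ⟨Finset.mem_univ _, hne⟩)
  apply hA
  ext i j
  have hbot : Submodule.span F (Set.range C.col) = ⊥ := by
    rw [Submodule.span_eq_bot]
    rintro _ ⟨j, rfl⟩
    exact hC j
  have hmem := h.2 j
  rw [hbot, Submodule.mem_bot] at hmem
  exact congrFun hmem i

/-- Every matrix with nonzero diagonal and rank at most half its size contains a principal
submatrix that is encoded by few entries relative to its off-diagonal support. -/
theorem exists_sparsely_encoded_principalPart {F V : Type*} [Field F] [Fintype V]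
    [DecidableEq V] [Nonempty V] (M : Matrix V V F) (hM : ∀ i, M i i ≠ 0)
    (hrank : 2 * M.rank ≤ Fintype.card V) :
    ∃ A C R : Matrix V V F, (∀ i j, A i j ≠ 0 → M i j ≠ 0) ∧ IsColPart C A ∧ IsColPart R (Aᵀ) ∧
      1 ≤ entryCount C ∧
      entryCount C * Fintype.card V ≤ 6 * M.rank * (offDiagSupport A).card ∧
      entryCount R * Fintype.card V ≤ 6 * M.rank * (offDiagSupport A).card := by
  classical
  obtain ⟨U, hU, hUmin⟩ := Finset.exists_min_image
    (Finset.univ.filter fun U : Finset V => U.Nonempty)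
    (fun U => ((principalPart M U).rank : ℚ) / U.card)
    ⟨Finset.univ, Finset.mem_filter.2 ⟨Finset.mem_univ _, Finset.univ_nonempty⟩⟩
  have hUne : U.Nonempty := (Finset.mem_filter.1 hU).2
  have hUpos : 0 < U.card := hUne.card_pos
  have hmin : ∀ W : Finset V,
      (principalPart M U).rank * W.card ≤ U.card * (principalPart M W).rank := by
    intro W
    rcases W.eq_empty_or_nonempty with rfl | hW
    · simp
    · have h := hUmin W (Finset.mem_filter.2 ⟨Finset.mem_univ _, hW⟩)
      have hWpos : 0 < W.card := hW.card_pos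
      rw [div_le_div_iff₀ (by exact_mod_cast hUpos) (by exact_mod_cast hWpos)] at h
      rw [mul_comm U.card]
      exact_mod_cast h
  have huniv := hmin Finset.univ
  rw [rank_principalPart_univ, Finset.card_univ] at huniv
  have hhalf : 2 * (principalPart M U).rank ≤ U.card := by
    have hVpos : 0 < Fintype.card V := Fintype.card_pos
    by_contra! hlt
    nlinarith
  obtain ⟨C, hC, hCcost⟩ := exists_sparse_isColPart M U fun W _ => hmin W
  obtain ⟨R, hR, hRcost⟩ := exists_sparse_isColPart (Mᵀ) U fun W _ => by
    rw [← transpose_principalPart, ← transpose_principalPart, Matrix.rank_transpose,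
      Matrix.rank_transpose]
    exact hmin W
  rw [← transpose_principalPart] at hR hRcost
  rw [Matrix.rank_transpose, entryCount_transpose] at hRcost
  have hcount := entryCount_principalPart_le M hM U hhalf
  have hbound : ∀ x : ℕ, U.card * x ≤
      (principalPart M U).rank * entryCount (principalPart M U) →
      x * Fintype.card V ≤ 6 * M.rank * (offDiagSupport (principalPart M U)).card := by
    intro x hx
    refine Nat.le_of_mul_le_mul_left ?_ hUpos
    calc U.card * (x * Fintype.card V) = U.card * x * Fintype.card V := by ring
      _ ≤ (principalPart M U).rank * (6 * (offDiagSupport (principalPart M U)).card) *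
          Fintype.card V :=
        Nat.mul_le_mul_right _ (hx.trans (Nat.mul_le_mul_left _ hcount))
      _ = (principalPart M U).rank * Fintype.card V *
          (6 * (offDiagSupport (principalPart M U)).card) := by ring
      _ ≤ U.card * M.rank * (6 * (offDiagSupport (principalPart M U)).card) :=
        Nat.mul_le_mul_right _ huniv
      _ = _ := by ring
  refine ⟨principalPart M U, C, R, fun i j h => ?_, hC, hR,
    one_le_entryCount_of_isColPart hC fun h => ?_, hbound _ hCcost, hbound _ hRcost⟩
  · intro h0
    exact h (by simp [principalPart, h0])
  · obtain ⟨i, hi⟩ := hUne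
    have h' := congrFun (congrFun h i) i
    simp [principalPart, hi, hM i] at h'

/-- The number of functions with at most `L` nonzero values. -/
theorem card_filter_support_le {P F : Type*} [Fintype P] [DecidableEq P] [Nonempty P] [Fintype F]
    [DecidableEq F] [Zero F] (L : ℕ) :
    (Finset.univ.filter fun f : P → F =>
      (Finset.univ.filter fun x => f x ≠ 0).card ≤ L).card ≤
      (Fintype.card P * Fintype.card F) ^ L := by
  induction L with
  | zero =>
    rw [pow_zero, Finset.card_le_one]
    have h0 : ∀ f ∈ Finset.univ.filter fun f : P → F =>
        (Finset.univ.filter fun x => f x ≠ 0).card ≤ 0, f = 0 := by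
      intro f hf
      have h := (Finset.mem_filter.1 hf).2
      rw [Nat.le_zero, Finset.card_eq_zero] at h
      ext x
      by_contra hx
      exact Finset.notMem_empty x (h ▸ Finset.mem_filter.2 ⟨Finset.mem_univ _, hx⟩)
    intro f hf g hg
    rw [h0 f hf, h0 g hg]
  | succ L ih =>
    have hsub : (Finset.univ.filter fun f : P → F =>
        (Finset.univ.filter fun x => f x ≠ 0).card ≤ L + 1) ⊆
        Finset.image₂ (fun (f : P → F) (x : P × F) => Function.update f x.1 x.2)
          (Finset.univ.filter fun f : P → F =>
            (Finset.univ.filter fun x => f x ≠ 0).card ≤ L) Finset.univ := by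
      intro f hf
      have hcard := (Finset.mem_filter.1 hf).2
      obtain ⟨x, hx⟩ : ∃ x : P, (∃ y, f y ≠ 0) → f x ≠ 0 := by
        by_cases h : ∃ y, f y ≠ 0
        · exact ⟨h.choose, fun _ => h.choose_spec⟩
        · exact ⟨Classical.arbitrary P, fun h' => absurd h' h⟩
      refine Finset.mem_image₂.2 ⟨Function.update f x 0, Finset.mem_filter.2
        ⟨Finset.mem_univ _, ?_⟩, (x, f x), Finset.mem_univ _, by simp⟩
      have hsub' : (Finset.univ.filter fun y => Function.update f x 0 y ≠ 0) ⊆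
          (Finset.univ.filter fun y => f y ≠ 0).erase x := by
        intro y hy
        have hy' := (Finset.mem_filter.1 hy).2
        by_cases hyx : y = x
        · subst hyx
          simp at hy'
        · rw [Function.update_of_ne hyx] at hy'
          exact Finset.mem_erase.2 ⟨hyx, Finset.mem_filter.2 ⟨Finset.mem_univ _, hy'⟩⟩
      refine (Finset.card_le_card hsub').trans ?_
      by_cases hfx : f x = 0
      · have hempty : (Finset.univ.filter fun y => f y ≠ 0) = ∅ :=
          Finset.filter_eq_empty_iff.2 fun y _ hy => hx ⟨y, hy⟩ hfx
        rw [hempty]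
        simp
      · have hmem : x ∈ Finset.univ.filter fun y => f y ≠ 0 :=
          Finset.mem_filter.2 ⟨Finset.mem_univ _, hfx⟩
        rw [Finset.card_erase_of_mem hmem]
        omega
    refine (Finset.card_le_card hsub).trans ((Finset.card_image₂_le _ _ _).trans ?_)
    rw [pow_succ, Finset.card_univ, Fintype.card_prod]
    exact Nat.mul_le_mul_right _ ih

theorem card_filter_entryCount_le {F V : Type*} [Field F] [Fintype F] [Fintype V]
    [DecidableEq V] [DecidableEq F] [Nonempty V] (L : ℕ) :
    (Finset.univ.filter fun C : Matrix V V F => entryCount C ≤ L).card ≤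
      (Fintype.card V ^ 2 * Fintype.card F) ^ L := by
  have h := card_filter_support_le (P := V × V) (F := F) L
  rw [Fintype.card_prod, ← pow_two] at h
  refine le_trans ?_ h
  refine Finset.card_le_card_of_injOn (fun C x => C x.1 x.2) ?_ ?_
  · intro C hC
    have hC' := (Finset.mem_filter.1 hC).2
    refine Finset.mem_filter.2 ⟨Finset.mem_univ _, ?_⟩
    unfold entryCount at hC'
    convert hC'
  · intro C _ D _ hCD
    ext i j
    exact congrFun hCD (i, j)

/-- The number of matrices encoded by a column part and a row part with at most `L` entries. -/
theorem card_sparsely_encoded_le {F V : Type*} [Field F] [Fintype F] [Fintype V]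
    [DecidableEq V] [DecidableEq F] [Nonempty V] (L : ℕ) (s : Finset (Matrix V V F))
    (hs : ∀ A ∈ s, ∃ C R : Matrix V V F, IsColPart C A ∧ IsColPart R (Aᵀ) ∧
      entryCount C ≤ L ∧ entryCount R ≤ L) :
    s.card ≤ (Fintype.card V ^ 2 * Fintype.card F) ^ (2 * L) := by
  choose! C R hC hR hCL hRL using hs
  set T := Finset.univ.filter fun C : Matrix V V F => entryCount C ≤ L with hT
  have h : s.card ≤ (T ×ˢ T).card := by
    refine Finset.card_le_card_of_injOn (fun A => (C A, R A)) ?_ ?_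
    · intro A hA
      exact Finset.mem_product.2 ⟨Finset.mem_filter.2 ⟨Finset.mem_univ _, hCL A hA⟩,
        Finset.mem_filter.2 ⟨Finset.mem_univ _, hRL A hA⟩⟩
    · intro A hA B hB hAB
      obtain ⟨h1, h2⟩ := Prod.mk.inj hAB
      have hCB := hC B hB
      have hRB := hR B hB
      rw [← h1] at hCB
      rw [← h2] at hRB
      exact eq_of_isColPart (hC A hA) hCB (hR A hA) hRB
  have hTcard : T.card ≤ _ := card_filter_entryCount_le L
  rw [Finset.card_product] at h
  refine h.trans ?_
  rw [two_mul, pow_add]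
  exact Nat.mul_le_mul hTcard hTcard

/-- The edge set of the complete graph on `K`. -/
def cliqueEdges {V : Type*} [DecidableEq V] (K : Finset V) : Finset (Sym2 V) :=
  K.offDiag.image (Function.uncurry Sym2.mk)

theorem mk_mem_cliqueEdges {V : Type*} [DecidableEq V] {K : Finset V} {i j : V} :
    s(i, j) ∈ cliqueEdges K ↔ i ∈ K ∧ j ∈ K ∧ i ≠ j := by
  simp only [cliqueEdges, Finset.mem_image, Finset.mem_offDiag, Prod.exists,
    Function.uncurry_apply_pair, Sym2.eq_iff]
  constructor
  · rintro ⟨a, b, ⟨ha, hb, hab⟩, ⟨rfl, rfl⟩ | ⟨rfl, rfl⟩⟩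
    · exact ⟨ha, hb, hab⟩
    · exact ⟨hb, ha, hab.symm⟩
  · rintro ⟨hi, hj, hij⟩
    exact ⟨i, j, ⟨hi, hj, hij⟩, Or.inl ⟨rfl, rfl⟩⟩

theorem card_filter_mem_cliqueEdges_le {V : Type*} [Fintype V] [DecidableEq V] (t : ℕ)
    (e : Sym2 V) :
    (((Finset.univ.powersetCard t).image (cliqueEdges (V := V))).filter (e ∈ ·)).card ≤
      Fintype.card V ^ (t - 2) := by
  induction e using Sym2.ind with
  | _ i j =>
    have hsub : ((Finset.univ.powersetCard t).image (cliqueEdges (V := V))).filter (s(i, j) ∈ ·) ⊆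
        ((Finset.univ : Finset V).powersetCard (t - 2)).image
          fun K => cliqueEdges (insert i (insert j K)) := by
      intro T hT
      obtain ⟨hT, he⟩ := Finset.mem_filter.1 hT
      obtain ⟨K, hK, rfl⟩ := Finset.mem_image.1 hT
      obtain ⟨hi, hj, hij⟩ := mk_mem_cliqueEdges.1 he
      have hjK : j ∈ K.erase i := Finset.mem_erase.2 ⟨hij.symm, hj⟩
      refine Finset.mem_image.2 ⟨(K.erase i).erase j, Finset.mem_powersetCard.2
        ⟨Finset.subset_univ _, ?_⟩, ?_⟩
      · rw [Finset.card_erase_of_mem hjK, Finset.card_erase_of_mem hi,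
          (Finset.mem_powersetCard.1 hK).2]
        omega
      · rw [Finset.insert_erase hjK, Finset.insert_erase hi]
    refine (Finset.card_le_card hsub).trans (Finset.card_image_le.trans ?_)
    rw [Finset.card_powersetCard, Finset.card_univ]
    exact Nat.choose_le_pow _ _

/-- The choice `p = n ^ (-2 / (t + 1)) / 8` of the edge probability: each edge lies in few
`t`-cliques on average. -/
theorem edge_probability_bound {t n : ℕ} (ht : 3 ≤ t) (hn : 1 ≤ n) {p : ℝ}
    (hp : p = (n : ℝ) ^ (-(2 / ((t : ℝ) + 1))) / 8) :
    (2 * p) ^ t.choose 2 * (n ^ (t - 2) : ℕ) ≤ p / 2 := by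
  have hnpos : (0 : ℝ) < n := by exact_mod_cast hn
  set a : ℝ := (n : ℝ) ^ (-(2 / ((t : ℝ) + 1))) with ha
  have ha0 : 0 < a := Real.rpow_pos_of_pos hnpos _
  have hpow : a ^ t.choose 2 * (n : ℝ) ^ (t - 2) = a := by
    rw [ha, ← Real.rpow_natCast, ← Real.rpow_mul hnpos.le, ← Real.rpow_natCast,
      ← Real.rpow_add hnpos, Nat.cast_choose_two, Nat.cast_sub (by omega)]
    congr 1
    have : (t : ℝ) + 1 ≠ 0 := by positivity
    push_cast
    field_simp
    ring
  have hC : 2 ≤ t.choose 2 := by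
    calc 2 ≤ Nat.choose 3 2 := by decide
      _ ≤ _ := Nat.choose_le_choose 2 ht
  have hquarter : ((1 : ℝ) / 4) ^ t.choose 2 ≤ (1 / 4) ^ 2 :=
    pow_le_pow_of_le_one (by norm_num) (by norm_num) hC
  calc (2 * p) ^ t.choose 2 * (n ^ (t - 2) : ℕ)
      = (1 / 4) ^ t.choose 2 * (a ^ t.choose 2 * (n : ℝ) ^ (t - 2)) := by
        rw [hp, show 2 * (a / 8) = 1 / 4 * a by ring, mul_pow]
        push_cast
        ring
    _ = (1 / 4) ^ t.choose 2 * a := by rw [hpow]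
    _ ≤ (1 / 4) ^ 2 * a := by gcongr
    _ = p / 2 := by rw [hp]; ring

/-- If the number of matrices in each class `s L` is at most `(n ^ 2 * q) ^ (2 * L)` and each of
them contributes at most `(n * q) ^ (-10 * L)`, the total contribution is less than `1`. -/
theorem sum_sigma_lt_one {α : Type*} {n q : ℕ} (hn : 2 ≤ n) (hq : 1 ≤ q) (s : ℕ → Finset α)
    (hs : ∀ L, (s L).card ≤ (n ^ 2 * q) ^ (2 * L)) (f : α → ℝ)
    (hf : ∀ L, ∀ A ∈ s L, f A ≤ Real.exp (-(10 * L * Real.log (n * q)))) :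
    ∑ x ∈ (Finset.Icc 1 (n ^ 2)).sigma s, f x.2 < 1 := by
  have hnR : (2 : ℝ) ≤ n := by exact_mod_cast hn
  have hqR : (1 : ℝ) ≤ q := by exact_mod_cast hq
  set y : ℝ := n * q with hy
  have hy2 : (n : ℝ) ≤ y := by rw [hy]; nlinarith
  have hy0 : 0 < y := by linarith
  rw [Finset.sum_sigma]
  have hterm : ∀ L ∈ Finset.Icc 1 (n ^ 2), ∑ A ∈ s L, f A ≤ (y ^ 6)⁻¹ := by
    intro L hL
    have hL1 := (Finset.mem_Icc.1 hL).1
    calc ∑ A ∈ s L, f A ≤ (s L).card • Real.exp (-(10 * L * Real.log y)) :=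
          Finset.sum_le_card_nsmul _ _ _ (hf L)
      _ = (s L).card * (y ^ (10 * L))⁻¹ := by
          rw [nsmul_eq_mul, Real.exp_neg, show 10 * (L : ℝ) * Real.log y =
            ((10 * L : ℕ) : ℝ) * Real.log y by push_cast; ring, Real.exp_nat_mul,
            Real.exp_log hy0]
      _ ≤ y ^ (4 * L) * (y ^ (10 * L))⁻¹ := by
          gcongr
          calc ((s L).card : ℝ) ≤ ((n ^ 2 * q) ^ (2 * L) : ℕ) := by exact_mod_cast hs L
            _ = ((n : ℝ) ^ 2 * q) ^ (2 * L) := by push_cast; ring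
            _ ≤ (y ^ 2) ^ (2 * L) := by
              gcongr
              rw [hy, mul_pow]
              gcongr
              nlinarith
            _ = y ^ (4 * L) := by rw [← pow_mul]; congr 1; ring
      _ = ((y ^ (6 * L)))⁻¹ := by
          rw [show 10 * L = 4 * L + 6 * L by ring, pow_add]
          field_simp
      _ ≤ (y ^ 6)⁻¹ := by
          gcongr
          · linarith
          · omega
  refine (Finset.sum_le_card_nsmul _ _ _ hterm).trans_lt ?_
  rw [Nat.card_Icc, nsmul_eq_mul, Nat.add_sub_cancel, ← div_eq_mul_inv, div_lt_one (by positivity)]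
  push_cast
  calc (n : ℝ) ^ 2 ≤ y ^ 2 := by gcongr
    _ < y ^ 6 := pow_lt_pow_right₀ (by linarith) (by norm_num)

theorem entryCount_le {F V : Type*} [Field F] [Fintype V] (A : Matrix V V F) :
    entryCount A ≤ Fintype.card V ^ 2 := by
  classical
  unfold entryCount
  refine (Finset.card_le_univ _).trans ?_
  rw [Fintype.card_prod, pow_two]

theorem exists_of_mem_offDiagSupport {F V : Type*} [Field F] [Fintype V] {A : Matrix V V F}
    {e : Sym2 V} (he : e ∈ offDiagSupport A) : ∃ i j, i ≠ j ∧ A i j ≠ 0 ∧ s(i, j) = e := by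
  classical
  unfold offDiagSupport at he
  obtain ⟨⟨i, j⟩, hij, rfl⟩ := Finset.mem_image.1 he
  obtain ⟨hne, hA⟩ := (Finset.mem_filter.1 hij).2
  exact ⟨i, j, hne, hA, rfl⟩

theorem exists_represents_rank_eq_minrk (F : Type*) [Field F] {V : Type*} [Fintype V]
    (G : SimpleGraph V) : ∃ M : Matrix V V F, Represents M G ∧ M.rank = minrk F G := by
  classical
  have hne : { r : ℕ | ∃ M : Matrix V V F, Represents M G ∧ M.rank = r }.Nonempty := by
    refine ⟨_, 1, ⟨fun v => ?_, fun u v huv _ => Matrix.one_apply_ne huv⟩, rfl⟩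
    rw [Matrix.one_apply_eq]
    exact one_ne_zero
  exact Nat.sInf_mem hne

/-- For `K` below `n / 2` with `n * p ≥ 120 * K * log (n * q)`, some graph with `K_t`-free
complement is represented only by matrices of rank at least `K`. -/
theorem exists_compl_free_le_minrk {t n : ℕ} (ht : 2 ≤ t) (hn : 2 ≤ n) (F : Type*) [Field F]
    [Fintype F] {p K : ℝ} (hp0 : 0 ≤ p) (hp2 : p ≤ 1 / 2)
    (hp : (2 * p) ^ t.choose 2 * (n ^ (t - 2) : ℕ) ≤ p / 2) (hK0 : 0 < K) (hKn : 2 * K ≤ n)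
    (hK : 120 * K * Real.log (n * Fintype.card F) ≤ p * n) :
    ∃ G : SimpleGraph (Fin n), ¬ ContainsCopy (⊤ : SimpleGraph (Fin t)) Gᶜ ∧ K ≤ minrk F G := by
  classical
  have : Nonempty (Fin n) := ⟨⟨0, by omega⟩⟩
  have hn0 : (0 : ℝ) < n := by exact_mod_cast (by omega : 0 < n)
  set s : ℕ → Finset (Matrix (Fin n) (Fin n) F) := fun L => Finset.univ.filter fun A =>
    (∃ C R : Matrix (Fin n) (Fin n) F, IsColPart C A ∧ IsColPart R (Aᵀ) ∧
      entryCount C ≤ L ∧ entryCount R ≤ L) ∧ (L : ℝ) * n ≤ 6 * K * (offDiagSupport A).card with hs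
  have hscard : ∀ L, (s L).card ≤ (n ^ 2 * Fintype.card F) ^ (2 * L) := by
    intro L
    have h := card_sparsely_encoded_le L (s L) fun A hA => (Finset.mem_filter.1 hA).2.1
    rwa [Fintype.card_fin] at h
  have hexp : ∀ L, ∀ A ∈ s L, Real.exp (-(p * (offDiagSupport A).card / 2)) ≤
      Real.exp (-(10 * L * Real.log (n * Fintype.card F))) := by
    intro L A hA
    have hL := (Finset.mem_filter.1 hA).2.2
    apply Real.exp_le_exp.2
    apply neg_le_neg
    have h1 : L * (120 * K * Real.log (n * Fintype.card F)) ≤ L * (p * n) := by gcongr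
    have h2 : p * (L * n) ≤ p * (6 * K * (offDiagSupport A).card) := by gcongr
    refine le_of_mul_le_mul_left ?_ (by positivity : 0 < 12 * K)
    linarith
  have hsum := sum_sigma_lt_one hn Fintype.card_pos s hscard
    (fun A => Real.exp (-(p * (offDiagSupport A).card / 2))) hexp
  obtain ⟨H, hfree, hhit⟩ := exists_avoiding_hitting
    (𝒯 := (Finset.univ.powersetCard t).image (cliqueEdges (V := Fin n)))
    (C := t.choose 2) (N := n ^ (t - 2)) (Nat.choose_pos ht)
    (by
      intro T hT
      obtain ⟨K, hK, rfl⟩ := Finset.mem_image.1 hT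
      rw [cliqueEdges, Sym2.card_image_offDiag, (Finset.mem_powersetCard.1 hK).2])
    (fun e => by simpa using card_filter_mem_cliqueEdges_le t e) hp0 hp2 hp
    ((Finset.Icc 1 (n ^ 2)).sigma s) (fun x => offDiagSupport x.2) hsum
  refine ⟨(SimpleGraph.fromEdgeSet (H : Set (Sym2 (Fin n))))ᶜ, ?_, ?_⟩
  · rintro ⟨f, hf, hadj⟩
    rw [compl_compl] at hadj
    refine hfree (cliqueEdges (Finset.univ.image f)) (Finset.mem_image.2 ⟨_,
      Finset.mem_powersetCard.2 ⟨Finset.subset_univ _, ?_⟩, rfl⟩) ?_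
    · rw [Finset.card_image_of_injective _ hf, Finset.card_univ, Fintype.card_fin]
    · intro e he
      induction e using Sym2.ind with
      | _ i j =>
        obtain ⟨hi, hj, hij⟩ := mk_mem_cliqueEdges.1 he
        obtain ⟨a, -, rfl⟩ := Finset.mem_image.1 hi
        obtain ⟨b, -, rfl⟩ := Finset.mem_image.1 hj
        have h := hadj a b (fun h => hij (congrArg f h))
        rw [SimpleGraph.fromEdgeSet_adj] at h
        exact_mod_cast h.1
  · by_contra! hlt
    obtain ⟨M, ⟨hdiag, hoff⟩, hrank⟩ := exists_represents_rank_eq_minrk F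
      (SimpleGraph.fromEdgeSet (H : Set (Sym2 (Fin n))))ᶜ
    rw [← hrank] at hlt
    have hhalf : 2 * M.rank ≤ Fintype.card (Fin n) := by
      rw [Fintype.card_fin]
      have : (2 : ℝ) * M.rank ≤ n := by linarith
      exact_mod_cast this
    obtain ⟨A, C, R, hAM, hCA, hRA, hC1, hCle, hRle⟩ :=
      exists_sparsely_encoded_principalPart M hdiag hhalf
    rw [Fintype.card_fin] at hCle hRle
    have hLn : max (entryCount C) (entryCount R) * n ≤ 6 * M.rank * (offDiagSupport A).card := by
      rcases max_choice (entryCount C) (entryCount R) with h | h <;> rw [h] <;> assumption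
    have hmem : (⟨max (entryCount C) (entryCount R), A⟩ :
        Σ _ : ℕ, Matrix (Fin n) (Fin n) F) ∈ (Finset.Icc 1 (n ^ 2)).sigma s := by
      refine Finset.mem_sigma.2 ⟨Finset.mem_Icc.2 ⟨hC1.trans (le_max_left _ _), max_le ?_ ?_⟩,
        Finset.mem_filter.2 ⟨Finset.mem_univ _,
          ⟨C, R, hCA, hRA, le_max_left _ _, le_max_right _ _⟩, ?_⟩⟩
      · simpa using entryCount_le C
      · simpa using entryCount_le R
      · calc _ ≤ 6 * (M.rank : ℝ) * (offDiagSupport A).card := by exact_mod_cast hLn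
          _ ≤ _ := by gcongr
    obtain ⟨e, heA, heH⟩ := hhit _ hmem
    obtain ⟨i, j, hne, hA, rfl⟩ := exists_of_mem_offDiagSupport heA
    refine hAM i j hA (hoff i j hne ?_)
    rw [SimpleGraph.compl_adj, SimpleGraph.fromEdgeSet_adj]
    exact fun h => h.2 ⟨by exact_mod_cast heH, hne⟩

/-- For every t ≥ 3 there is c > 0 such that for every n ≥ 2 and finite field F
there is an n-vertex graph G whose complement is K_t-free (i.e. α(G) ≤ t-1) with
minrk_F(G) ≥ c · n^{1-2/(t+1)} / log(n·|F|). -/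
theorem exists_compl_Kt_free_minrk_ge (t : ℕ) (ht : 3 ≤ t) :
    ∃ c : ℝ, 0 < c ∧ ∀ n : ℕ, 2 ≤ n → ∀ (F : Type) [Field F] [Fintype F],
      ∃ G : SimpleGraph (Fin n), ¬ ContainsCopy (⊤ : SimpleGraph (Fin t)) Gᶜ ∧
        c * (n : ℝ) ^ (1 - 2 / ((t : ℝ) + 1)) /
          Real.log ((n : ℝ) * (Fintype.card F : ℝ)) ≤ (minrk F G : ℝ) := by
  refine ⟨1 / 960, by norm_num, fun n hn F _ _ => ?_⟩
  have hn1 : (1 : ℝ) ≤ n := by exact_mod_cast (by omega : 1 ≤ n)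
  have hn0 : (0 : ℝ) < n := by linarith
  have hexponent : 0 ≤ 2 / ((t : ℝ) + 1) := by positivity
  set ℓ := Real.log ((n : ℝ) * (Fintype.card F : ℝ)) with hℓ
  have hℓ1 : 1 ≤ ℓ := by
    have hq : (2 : ℝ) ≤ Fintype.card F := by exact_mod_cast Fintype.one_lt_card (α := F)
    have hn2 : (2 : ℝ) ≤ n := by exact_mod_cast hn
    rw [hℓ, Real.le_log_iff_exp_le (by positivity)]
    have := Real.exp_one_lt_d9
    nlinarith
  have hℓ0 : 0 < ℓ := by linarith
  have hsplit : (n : ℝ) ^ (1 - 2 / ((t : ℝ) + 1)) = n * (n : ℝ) ^ (-(2 / ((t : ℝ) + 1))) := by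
    rw [sub_eq_add_neg, Real.rpow_add hn0, Real.rpow_one]
  have ha0 : 0 < (n : ℝ) ^ (-(2 / ((t : ℝ) + 1))) := Real.rpow_pos_of_pos hn0 _
  have ha1 : (n : ℝ) ^ (-(2 / ((t : ℝ) + 1))) ≤ 1 :=
    Real.rpow_le_one_of_one_le_of_nonpos hn1 (by linarith)
  refine exists_compl_free_le_minrk (p := (n : ℝ) ^ (-(2 / ((t : ℝ) + 1))) / 8) (by omega) hn F
    (by positivity) (by linarith) (edge_probability_bound ht (by omega) rfl) (by positivity) ?_ ?_
  · rw [hsplit, ← mul_div_assoc, div_le_iff₀ hℓ0]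
    nlinarith
  · rw [← hℓ, hsplit]
    apply le_of_eq
    field_simp
    norm_num
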